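/- Every K_4-minor-free graph of odd-girth at least 2k+1 has fractional chromatic number at most 2 + 1/k, and this bound is attained by the cycle C_{2k+1}. -/

import Mathlib

open SimpleGraph

/-- The Kneser graph `K(n,r)`: vertices are the `r`-element subsets of an `n`-set,
adjacent iff disjoint. -/
def Kneser (n r : ℕ) : SimpleGraph {s : Finset (Fin n) // s.card = r} :=
  SimpleGraph.fromRel fun a b => Disjoint a.1 b.1

/-- `G` has odd-girth at least `n`: every odd cycle has length at least `n`. -/
def oddGirthAtLeast {V : Type*} (G : SimpleGraph V) (n : ℕ) : Prop :=
  ∀ (x : V) (w : G.Walk x x), w.IsCycle → Odd w.length → n ≤ w.length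

/-- `G` has a `K₄` minor: there are four nonempty, pairwise disjoint, connected
branch sets with an edge of `G` between every two of them. -/
def HasK4Minor {V : Type*} (G : SimpleGraph V) : Prop :=
  ∃ S : Fin 4 → Set V,
    (∀ i, (S i).Nonempty) ∧
    (∀ i, (G.induce (S i)).Connected) ∧
    (Pairwise fun i j => Disjoint (S i) (S j)) ∧
    (Pairwise fun i j => ∃ a ∈ S i, ∃ b ∈ S j, G.Adj a b)

/-- The fractional chromatic number of `G`: the infimum of `p/q` over positive
integers `p, q` such that `G` admits a homomorphism to the Kneser graph `K(p,q)`. -/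
noncomputable def fracChromaticNumber {V : Type*} (G : SimpleGraph V) : ℝ :=
  sInf {x : ℝ | ∃ p q : ℕ, 0 < p ∧ 0 < q ∧ x = (p : ℝ) / q ∧ Nonempty (G →g Kneser p q)}

/-- The cycle of length `n`, on `ZMod n`. -/
def cycleGraphZ (n : ℕ) : SimpleGraph (ZMod n) :=
  SimpleGraph.fromRel fun a b => b = a + 1

/-- If all odd cycles have length at least `N`, then every walk can be shortened to a path
with the same endpoints, and of the same length parity unless the walk has length at least `N`. -/
theorem oddGirthAtLeast.exists_isPath {V : Type*} {G : SimpleGraph V} {N : ℕ}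
    (hG : oddGirthAtLeast G N) {u v : V} (p : G.Walk u v) :
    ∃ q : G.Walk u v, q.IsPath ∧ q.length ≤ p.length ∧
      (q.length % 2 = p.length % 2 ∨ N ≤ p.length) := by
  classical
  induction p with
  | nil => exact ⟨.nil, by simp, le_rfl, .inl rfl⟩
  | @cons a b c h p ih =>
    obtain ⟨q, hq, hle, hpar⟩ := ih
    by_cases ha : a ∈ q.support
    · have hlen : (q.takeUntil a ha).length + (q.dropUntil a ha).length = q.length := by
        rw [← Walk.length_append, Walk.take_spec]
      refine ⟨q.dropUntil a ha, hq.dropUntil ha, by simp; omega, ?_⟩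
      by_cases hodd : Odd (q.takeUntil a ha).length
      · rw [Nat.odd_iff] at hodd
        simp only [Walk.length_cons]
        omega
      right
      have htake := hq.takeUntil ha
      have hcyc : (Walk.cons h (q.takeUntil a ha)).IsCycle := by
        rw [Walk.cons_isCycle_iff]
        refine ⟨htake, fun hmem => ?_⟩
        generalize q.takeUntil a ha = r at *
        cases r with
        | nil => exact h.ne rfl
        | cons h' r =>
          rw [Walk.cons_isPath_iff] at htake
          rw [Walk.edges_cons, List.mem_cons] at hmem
          rcases hmem with hmem | hmem
          · rw [Sym2.eq_iff] at hmem
            rcases hmem with ⟨h1, h2⟩ | ⟨h1, -⟩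
            · exact h.ne h1
            · subst h1
              have := (Walk.isPath_iff_nil.1 htake.1).eq_nil
              subst this
              simp at hodd
          · exact htake.2 (r.snd_mem_support_of_mem_edges hmem)
      have := hG _ _ hcyc (by
        rw [Walk.length_cons, Nat.odd_add_one]; exact hodd)
      simp only [Walk.length_cons] at this ⊢
      omega
    · exact ⟨.cons h q, hq.cons ha, by simpa, by simp only [Walk.length_cons]; omega⟩

theorem oddGirthAtLeast.le_length {V : Type*} {G : SimpleGraph V} {N : ℕ}
    (hG : oddGirthAtLeast G N) {v : V} (p : G.Walk v v) (hp : Odd p.length) : N ≤ p.length := by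
  obtain ⟨q, hq, -, h⟩ := hG.exists_isPath p
  rw [(Walk.isPath_iff_nil.1 hq).eq_nil] at h
  rw [Nat.odd_iff] at hp
  simpa [hp] using h

/-- A `k`-half-metric: a symmetric weight `V → V → {0, …, k}` all of whose triples can be realised
by the sizes of differences of three `k`-subsets of a `(2k+1)`-set. -/
structure IsHalfMetric {V : Type*} (k : ℕ) (f : V → V → ℕ) : Prop where
  symm : ∀ x y, f x y = f y x
  le : ∀ x y, f x y ≤ k
  triangle : ∀ x y z, f x z ≤ f x y + f y z
  perimeter : ∀ x y z, f x y + f y z + f x z ≤ 2 * k + 1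

/-- The distance in `G`, truncated at `k`. -/
noncomputable def truncDist {V : Type*} (G : SimpleGraph V) (k : ℕ) (x y : V) : ℕ :=
  open Classical in if G.Reachable x y then min k (G.dist x y) else k

theorem truncDist_le {V : Type*} (G : SimpleGraph V) (k : ℕ) (x y : V) :
    truncDist G k x y ≤ k := by
  unfold truncDist; split_ifs <;> simp

theorem truncDist_comm {V : Type*} (G : SimpleGraph V) (k : ℕ) (x y : V) :
    truncDist G k x y = truncDist G k y x := by
  unfold truncDist
  rw [SimpleGraph.dist_comm, SimpleGraph.reachable_comm]

theorem truncDist_triangle {V : Type*} (G : SimpleGraph V) (k : ℕ) (x y z : V) :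
    truncDist G k x z ≤ truncDist G k x y + truncDist G k y z := by
  unfold truncDist
  by_cases h1 : G.Reachable x y
  · by_cases h2 : G.Reachable y z
    · have := h1.dist_triangle_left z
      simp only [h1, h2, h1.trans h2, if_true]
      omega
    · simp only [h2, if_false]
      split_ifs <;> omega
  · simp only [h1, if_false]
    split_ifs <;> omega

theorem truncDist_spec {V : Type*} (G : SimpleGraph V) (k : ℕ) (x y : V) :
    truncDist G k x y = k ∨ ∃ p : G.Walk x y, p.length = truncDist G k x y := by
  unfold truncDist
  by_cases h : G.Reachable x y
  · simp only [h, if_true]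
    obtain ⟨p, hp⟩ := h.exists_walk_length_eq_dist
    rcases le_total k (G.dist x y) with h' | h'
    · exact .inl (min_eq_left h')
    · exact .inr ⟨p, by rw [hp, min_eq_right h']⟩
  · simp [h]

theorem truncDist_odd_perimeter {V : Type*} {G : SimpleGraph V} {k : ℕ}
    (hG : oddGirthAtLeast G (2 * k + 1)) (x y z : V)
    (h : Odd (truncDist G k x y + truncDist G k y z + truncDist G k x z)) :
    2 * k + 1 ≤ truncDist G k x y + truncDist G k y z + truncDist G k x z := by
  have t1 := truncDist_triangle G k x y z
  have t2 := truncDist_triangle G k x z y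
  have t3 := truncDist_triangle G k y x z
  rw [truncDist_comm G k z y] at t2
  rw [truncDist_comm G k y x] at t3
  have h' := Nat.odd_iff.1 h
  rcases truncDist_spec G k x y with h1 | ⟨p, hp⟩
  · omega
  rcases truncDist_spec G k y z with h1 | ⟨q, hq⟩
  · omega
  rcases truncDist_spec G k x z with h1 | ⟨r, hr⟩
  · omega
  rw [← hp, ← hq, ← hr] at h ⊢
  simpa using hG.le_length ((p.append q).append r.reverse) (by simpa using h)

/-- Half of the even one of the numbers `d` and `2k+1-d`, for `d` the truncated distance. -/
noncomputable def halfDist {V : Type*} (G : SimpleGraph V) (k : ℕ) (x y : V) : ℕ :=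
  if truncDist G k x y % 2 = 0 then truncDist G k x y / 2 else k - truncDist G k x y / 2

theorem isHalfMetric_halfDist {V : Type*} {G : SimpleGraph V} {k : ℕ}
    (hG : oddGirthAtLeast G (2 * k + 1)) : IsHalfMetric k (halfDist G k) := by
  have key (x y z : V) : halfDist G k x z ≤ halfDist G k x y + halfDist G k y z ∧
      halfDist G k x y + halfDist G k y z + halfDist G k x z ≤ 2 * k + 1 := by
    have t1 := truncDist_triangle G k x y z
    have t2 := truncDist_triangle G k x z y
    have t3 := truncDist_triangle G k y x z
    rw [truncDist_comm G k z y] at t2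
    rw [truncDist_comm G k y x] at t3
    have h := truncDist_odd_perimeter hG x y z
    have b1 := truncDist_le G k x y
    have b2 := truncDist_le G k y z
    have b3 := truncDist_le G k x z
    rw [Nat.odd_iff] at h
    unfold halfDist
    generalize truncDist G k x y = a at *
    generalize truncDist G k y z = b at *
    generalize truncDist G k x z = c at *
    split_ifs <;> omega
  refine ⟨fun x y => ?_, fun x y => ?_, fun x y z => (key x y z).1, fun x y z => (key x y z).2⟩
  · simp only [halfDist, truncDist_comm]
  · have := truncDist_le G k x y
    unfold halfDist
    split_ifs <;> omega

theorem halfDist_of_adj {V : Type*} {G : SimpleGraph V} {k : ℕ} (hk : 1 ≤ k) {x y : V}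
    (h : G.Adj x y) : halfDist G k x y = k := by
  have : truncDist G k x y = 1 := by
    simp [truncDist, h.reachable, SimpleGraph.dist_eq_one_iff_adj.2 h, hk]
  simp [halfDist, this]

/-- Two `k`-subsets of a `(2k+1)`-set can be extended by a third one with prescribed differences. -/
theorem exists_card_sdiff_eq {α : Type*} [Fintype α] [DecidableEq α] {k q r : ℕ}
    (hα : Fintype.card α = 2 * k + 1) (A B : Finset α)
    (hA : A.card = k) (hB : B.card = k) (hq : q ≤ k) (hr : r ≤ k)
    (h1 : (A \ B).card ≤ q + r) (h2 : q ≤ (A \ B).card + r) (h3 : r ≤ (A \ B).card + q)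
    (h4 : (A \ B).card + q + r ≤ 2 * k + 1) :
    ∃ C : Finset α, C.card = k ∧ (C \ A).card = q ∧ (C \ B).card = r := by
  obtain ⟨p, hp⟩ : ∃ p, p = (A \ B).card := ⟨_, rfl⟩
  rw [← hp] at h1 h2 h3 h4
  have e1 : (A ∩ B).card + p = k := by
    rw [hp, Finset.card_inter_add_card_sdiff, hA]
  have e2 : (B \ A).card = p := by
    have := Finset.card_inter_add_card_sdiff B A
    rw [Finset.inter_comm] at this
    omega
  have e3 : ((A ∪ B)ᶜ).card + p = k + 1 := by
    have := Finset.card_union_add_card_inter A B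
    rw [Finset.card_compl, hα]
    omega
  obtain ⟨t, s, m, o, a1, a2, a3, a4, a5, a6, a7⟩ : ∃ t s m o : ℕ, t + s + q = k ∧
      t + m + r = k ∧ t + s + m + o = k ∧ t + p ≤ k ∧ s ≤ p ∧ m ≤ p ∧ o + p ≤ k + 1 := by
    refine ⟨max (k - q - p) (max (k - r - p) (k - q - r)), ?_⟩
    generalize ht : max (k - q - p) (max (k - r - p) (k - q - r)) = t
    refine ⟨k - q - t, k - r - t, q + r + t - k, ?_⟩
    omega
  obtain ⟨T, hT, hTc⟩ := Finset.exists_subset_card_eq (s := A ∩ B) (n := t) (by omega)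
  obtain ⟨S, hS, hSc⟩ := Finset.exists_subset_card_eq (s := A \ B) (n := s) (by omega)
  obtain ⟨R, hR, hRc⟩ := Finset.exists_subset_card_eq (s := B \ A) (n := m) (by omega)
  obtain ⟨O, hO, hOc⟩ := Finset.exists_subset_card_eq (s := (A ∪ B)ᶜ) (n := o) (by omega)
  have hT' : ∀ x ∈ T, x ∈ A ∧ x ∈ B := fun x hx => by simpa using hT hx
  have hS' : ∀ x ∈ S, x ∈ A ∧ x ∉ B := fun x hx => by simpa using hS hx
  have hR' : ∀ x ∈ R, x ∈ B ∧ x ∉ A := fun x hx => by simpa using hR hx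
  have hO' : ∀ x ∈ O, x ∉ A ∧ x ∉ B := fun x hx => by simpa using hO hx
  have dRO : Disjoint R O := Finset.disjoint_left.2 fun x h h' => (hO' x h').2 (hR' x h).1
  have dSO : Disjoint S O := Finset.disjoint_left.2 fun x h h' => (hO' x h').1 (hS' x h).1
  have dTS : Disjoint T S := Finset.disjoint_left.2 fun x h h' => (hS' x h').2 (hT' x h).2
  have dTSRO : Disjoint (T ∪ S) (R ∪ O) := Finset.disjoint_left.2 fun x h h' => by
    rw [Finset.mem_union] at h h'
    grind
  have cRO := Finset.card_union_of_disjoint dRO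
  have cSO := Finset.card_union_of_disjoint dSO
  have cTS := Finset.card_union_of_disjoint dTS
  have cTSRO := Finset.card_union_of_disjoint dTSRO
  have E1 : ((T ∪ S) ∪ (R ∪ O)) \ A = R ∪ O := by ext x; grind
  have E2 : ((T ∪ S) ∪ (R ∪ O)) \ B = S ∪ O := by ext x; grind
  exact ⟨(T ∪ S) ∪ (R ∪ O), by omega, by rw [E1]; omega, by rw [E2]; omega⟩

theorem two_mul_card_le_of_forall_add_one_notMem {k : ℕ} (I : Finset (ZMod (2 * k + 1)))
    (hI : ∀ a ∈ I, a + 1 ∉ I) : I.card ≤ k := by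
  have hd : Disjoint I (I.map (addRightEmbedding 1)) := by
    rw [Finset.disjoint_left]
    intro a ha ha'
    obtain ⟨b, hb, rfl⟩ := Finset.mem_map.1 ha'
    exact hI b hb ha
  have h := Finset.card_le_univ (I ∪ I.map (addRightEmbedding 1))
  rw [Finset.card_union_of_disjoint hd, Finset.card_map, ZMod.card] at h
  omega

theorem cycleGraphZ_adj_add_one {k : ℕ} (hk : 1 ≤ k) (a : ZMod (2 * k + 1)) :
    (cycleGraphZ (2 * k + 1)).Adj a (a + 1) := by
  have : Fact (1 < 2 * k + 1) := ⟨by omega⟩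
  simp [cycleGraphZ]

theorem Kneser_adj_iff {n r : ℕ} (hr : 0 < r) (a b : {s : Finset (Fin n) // s.card = r}) :
    (Kneser n r).Adj a b ↔ Disjoint a.1 b.1 := by
  simp only [Kneser, SimpleGraph.fromRel_adj]
  constructor
  · rintro ⟨-, h | h⟩
    exacts [h, h.symm]
  · refine fun h => ⟨?_, .inl h⟩
    rintro rfl
    rw [disjoint_self, Finset.bot_eq_empty] at h
    have := a.2
    simp [h] at this
    omega

theorem mul_le_of_cycleGraphZ_hom_Kneser {k p q : ℕ} (hk : 1 ≤ k) (hq : 0 < q)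
    (φ : cycleGraphZ (2 * k + 1) →g Kneser p q) : (2 * k + 1) * q ≤ p * k := by
  classical
  calc (2 * k + 1) * q = ∑ i : ZMod (2 * k + 1), (φ i).1.card := by
        simp [(φ _).2, ZMod.card]
    _ = ∑ i : ZMod (2 * k + 1), ∑ c : Fin p, if c ∈ (φ i).1 then 1 else 0 := by simp
    _ = ∑ c : Fin p, ∑ i : ZMod (2 * k + 1), if c ∈ (φ i).1 then 1 else 0 := Finset.sum_comm
    _ ≤ ∑ _c : Fin p, k := by
        refine Finset.sum_le_sum fun c _ => ?_
        rw [← Finset.card_filter]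
        refine two_mul_card_le_of_forall_add_one_notMem _ fun a ha hb => ?_
        have := (Kneser_adj_iff hq _ _).1 (φ.map_adj (cycleGraphZ_adj_add_one hk a))
        simp only [Finset.mem_filter, Finset.mem_univ, true_and] at ha hb
        exact Finset.disjoint_left.1 this ha hb
    _ = p * k := by simp

theorem card_filter_val_sub_lt {k : ℕ} (a : ZMod (2 * k + 1)) :
    (Finset.univ.filter fun c : ZMod (2 * k + 1) => (c - a).val < k).card = k := by
  have : (Finset.univ.filter fun c : ZMod (2 * k + 1) => (c - a).val < k) =
      (Finset.range k).image fun j : ℕ => (j : ZMod (2 * k + 1)) + a := by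
    ext c
    simp only [Finset.mem_filter, Finset.mem_univ, true_and, Finset.mem_image, Finset.mem_range]
    constructor
    · exact fun h => ⟨(c - a).val, h, by simp⟩
    · rintro ⟨j, hj, rfl⟩
      rwa [add_sub_cancel_right, ZMod.val_natCast, Nat.mod_eq_of_lt (by omega)]
  rw [this, Finset.card_image_of_injOn, Finset.card_range]
  intro i hi j hj h
  have h' := congrArg ZMod.val (add_right_cancel h)
  simp only [Finset.coe_range, Set.mem_Iio] at hi hj
  rwa [ZMod.val_natCast, ZMod.val_natCast, Nat.mod_eq_of_lt (by omega),
    Nat.mod_eq_of_lt (by omega)] at h'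

theorem disjoint_filter_val_sub_lt {k : ℕ} (a : ZMod (2 * k + 1)) :
    Disjoint (Finset.univ.filter fun c : ZMod (2 * k + 1) => (c - a).val < k)
      (Finset.univ.filter fun c : ZMod (2 * k + 1) => (c - (a + k)).val < k) := by
  rw [Finset.disjoint_left]
  intro c h1 h2
  simp only [Finset.mem_filter, Finset.mem_univ, true_and] at h1 h2
  have h3 : c - a = (((c - (a + k)).val + k : ℕ) : ZMod (2 * k + 1)) := by
    push_cast
    rw [ZMod.natCast_zmod_val]
    ring
  rw [h3, ZMod.val_natCast, Nat.mod_eq_of_lt (by omega)] at h1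
  omega

theorem nonempty_cycleGraphZ_hom_Kneser {k : ℕ} (hk : 1 ≤ k) :
    Nonempty (cycleGraphZ (2 * k + 1) →g Kneser (2 * k + 1) k) := by
  let e : ZMod (2 * k + 1) ≃ Fin (2 * k + 1) := (ZMod.finEquiv (2 * k + 1)).symm.toEquiv
  have key (a : ZMod (2 * k + 1)) : Disjoint
      ((Finset.univ.filter fun c : ZMod (2 * k + 1) => (c - a * k).val < k).map e.toEmbedding)
      ((Finset.univ.filter fun c : ZMod (2 * k + 1) => (c - (a + 1) * k).val < k).map
        e.toEmbedding) := by
    rw [Finset.disjoint_map, add_mul, one_mul]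
    exact disjoint_filter_val_sub_lt _
  refine ⟨⟨fun a => ⟨(Finset.univ.filter fun c : ZMod (2 * k + 1) =>
    (c - a * k).val < k).map e.toEmbedding, ?_⟩, ?_⟩⟩
  · rw [Finset.card_map, card_filter_val_sub_lt]
  · intro a b h
    rw [Kneser_adj_iff hk]
    simp only [cycleGraphZ, SimpleGraph.fromRel_adj] at h
    obtain ⟨-, rfl | rfl⟩ := h
    · exact key a
    · exact (key b).symm

theorem fracChromaticNumber_le_of_hom {V : Type*} {G : SimpleGraph V} {p q : ℕ} (hp : 0 < p)
    (hq : 0 < q) (φ : G →g Kneser p q) : fracChromaticNumber G ≤ (p : ℝ) / q := by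
  refine csInf_le ⟨0, ?_⟩ ⟨p, q, hp, hq, rfl, ⟨φ⟩⟩
  rintro x ⟨p, q, -, -, rfl, -⟩
  positivity

theorem fracChromaticNumber_cycleGraphZ {k : ℕ} (hk : 1 ≤ k) :
    fracChromaticNumber (cycleGraphZ (2 * k + 1)) = 2 + 1 / (k : ℝ) := by
  have hk' : (0 : ℝ) < k := by exact_mod_cast hk
  have hval : (((2 * k + 1 : ℕ) : ℝ)) / k = 2 + 1 / k := by push_cast; field_simp
  obtain ⟨φ⟩ := nonempty_cycleGraphZ_hom_Kneser hk
  refine le_antisymm (hval ▸ fracChromaticNumber_le_of_hom (by omega) hk φ) ?_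
  refine le_csInf ⟨_, 2 * k + 1, k, by omega, hk, rfl, ⟨φ⟩⟩ ?_
  rintro x ⟨p, q, -, hq, rfl, ⟨ψ⟩⟩
  have h := mul_le_of_cycleGraphZ_hom_Kneser hk hq ψ
  have hq' : (0 : ℝ) < q := by exact_mod_cast hq
  rw [← hval, div_le_div_iff₀ hk' hq']
  exact_mod_cast h

theorem connected_induce_of_star {V : Type*} {G : SimpleGraph V} {T : Set V} {c : V} (hc : c ∈ T)
    (h : ∀ a ∈ T, a ≠ c → G.Adj c a) : (G.induce T).Connected := by
  rw [SimpleGraph.connected_iff_exists_forall_reachable]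
  refine ⟨⟨c, hc⟩, fun ⟨a, ha⟩ => ?_⟩
  by_cases hac : a = c
  · subst hac; rfl
  · exact SimpleGraph.Adj.reachable (by simpa using h a ha hac)

/-- If `H` is modelled by connected, disjoint branch sets in `G`, then a `K₄` minor of `H` yields
one of `G`. -/
theorem HasK4Minor.of_branchSets {V W : Type*} {G : SimpleGraph V} {H : SimpleGraph W}
    (β : W → Set V) (hconn : ∀ w, (G.induce (β w)).Connected)
    (hdisj : ∀ x y a, a ∈ β x → a ∈ β y → x = y)
    (hadj : ∀ x y, H.Adj x y → ∃ a ∈ β x, ∃ b ∈ β y, G.Adj a b) (hH : HasK4Minor H) :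
    HasK4Minor G := by
  obtain ⟨S, hne, hc, hd, ha⟩ := hH
  have hmem {i : Fin 4} {w : W} (hw : w ∈ S i) {x : V} (hx : x ∈ β w) : x ∈ ⋃ w ∈ S i, β w :=
    Set.mem_biUnion hw hx
  have inner {i : Fin 4} {w : W} (hw : w ∈ S i) {x y : V} (hx : x ∈ β w) (hy : y ∈ β w) :
      (G.induce (⋃ w ∈ S i, β w)).Reachable ⟨x, hmem hw hx⟩ ⟨y, hmem hw hy⟩ :=
    ((hconn w).preconnected ⟨x, hx⟩ ⟨y, hy⟩).map
      (G.induceHomOfLE (Set.subset_biUnion_of_mem hw)).toHom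
  have outer {i : Fin 4} {w w' : S i} (p : (H.induce (S i)).Walk w w') : ∀ (x y : V)
      (hx : x ∈ β w) (hy : y ∈ β w'),
      (G.induce (⋃ w ∈ S i, β w)).Reachable ⟨x, hmem w.2 hx⟩ ⟨y, hmem w'.2 hy⟩ := by
    induction p with
    | nil => exact fun x y hx hy => inner (Subtype.prop _) hx hy
    | @cons a b c h p ih =>
      intro x y hx hy
      obtain ⟨x', hx', y', hy', hxy⟩ := hadj a b (by simpa using h)
      have hstep : (G.induce (⋃ w ∈ S i, β w)).Adj ⟨x', hmem a.2 hx'⟩ ⟨y', hmem b.2 hy'⟩ := by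
        simpa using hxy
      exact ((inner a.2 hx hx').trans hstep.reachable).trans (ih y' y hy' hy)
  have pick (w : W) : ∃ x, x ∈ β w := by
    obtain ⟨x⟩ := (hconn w).nonempty
    exact ⟨x, x.2⟩
  refine ⟨fun i => ⋃ w ∈ S i, β w, fun i => ?_, fun i => ?_, fun i j hij => ?_, fun i j hij => ?_⟩
  · obtain ⟨w, hw⟩ := hne i
    obtain ⟨x, hx⟩ := pick w
    exact ⟨x, hmem hw hx⟩
  · obtain ⟨w, hw⟩ := hne i
    obtain ⟨x, hx⟩ := pick w
    rw [SimpleGraph.connected_iff_exists_forall_reachable]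
    refine ⟨⟨x, hmem hw hx⟩, fun ⟨y, hy⟩ => ?_⟩
    obtain ⟨w', hw', hy'⟩ := Set.mem_iUnion₂.1 hy
    obtain ⟨p⟩ := (hc i).preconnected ⟨w, hw⟩ ⟨w', hw'⟩
    exact outer p x y hx hy'
  · refine Set.disjoint_left.2 fun a h1 h2 => ?_
    obtain ⟨w, hw, h1⟩ := Set.mem_iUnion₂.1 h1
    obtain ⟨w', hw', h2⟩ := Set.mem_iUnion₂.1 h2
    obtain rfl := hdisj _ _ _ h1 h2
    exact Set.disjoint_left.1 (hd hij) hw hw'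
  · obtain ⟨w, hw, w', hw', h⟩ := ha hij
    obtain ⟨a, ha, b, hb, hab⟩ := hadj _ _ h
    exact ⟨a, hmem hw ha, b, hmem hw' hb, hab⟩

/-- Three pairwise adjacent vertices, all with neighbours in a connected set avoiding them, form a
`K₄` minor. -/
theorem hasK4Minor_of_triangle {V : Type*} {G : SimpleGraph V} {a b c : V} {Y : Set V}
    (hab : G.Adj a b) (hac : G.Adj a c) (hbc : G.Adj b c) (hY : (G.induce Y).Connected)
    (ha : a ∉ Y) (hb : b ∉ Y) (hc : c ∉ Y) (ha' : ∃ y ∈ Y, G.Adj a y) (hb' : ∃ y ∈ Y, G.Adj b y)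
    (hc' : ∃ y ∈ Y, G.Adj c y) : HasK4Minor G := by
  have hs (x : V) : (G.induce {x}).Connected := connected_induce_of_star rfl (by simp)
  obtain ⟨y1, hy1, h1⟩ := ha'
  obtain ⟨y2, hy2, h2⟩ := hb'
  obtain ⟨y3, hy3, h3⟩ := hc'
  refine ⟨![{a}, {b}, {c}, Y], ?_, ?_, ?_, ?_⟩
  · intro i
    fin_cases i
    exacts [⟨a, rfl⟩, ⟨b, rfl⟩, ⟨c, rfl⟩, ⟨y1, hy1⟩]
  · intro i
    fin_cases i
    exacts [hs a, hs b, hs c, hY]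
  · intro i j hij
    fin_cases i <;> fin_cases j <;>
      simp_all [hab.ne, hac.ne, hbc.ne, hab.ne', hac.ne', hbc.ne']
  · intro i j hij
    fin_cases i <;> fin_cases j
    exacts [absurd rfl hij, ⟨a, rfl, b, rfl, hab⟩, ⟨a, rfl, c, rfl, hac⟩, ⟨a, rfl, y1, hy1, h1⟩,
      ⟨b, rfl, a, rfl, hab.symm⟩, absurd rfl hij, ⟨b, rfl, c, rfl, hbc⟩, ⟨b, rfl, y2, hy2, h2⟩,
      ⟨c, rfl, a, rfl, hac.symm⟩, ⟨c, rfl, b, rfl, hbc.symm⟩, absurd rfl hij,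
      ⟨c, rfl, y3, hy3, h3⟩, ⟨y1, hy1, a, rfl, h1.symm⟩, ⟨y2, hy2, b, rfl, h2.symm⟩,
      ⟨y3, hy3, c, rfl, h3.symm⟩, absurd rfl hij]

/-- The vertex `v` has at least three neighbours. -/
def HasThreeNeighbors {V : Type*} (G : SimpleGraph V) (v : V) : Prop :=
  ∃ a b c, a ≠ b ∧ a ≠ c ∧ b ≠ c ∧ G.Adj v a ∧ G.Adj v b ∧ G.Adj v c

/-- The graph obtained from `G` by contracting the vertex set `T` to its element `r`. -/
def contract {V : Type*} (G : SimpleGraph V) (T : Set V) (r : V) :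
    SimpleGraph {x : V // x ∉ T ∨ x = r} where
  Adj x y := x ≠ y ∧ ∃ a b, (a = x.1 ∨ x.1 = r ∧ a ∈ T) ∧ (b = y.1 ∨ y.1 = r ∧ b ∈ T) ∧ G.Adj a b
  symm := ⟨fun _ _ ⟨h, a, b, ha, hb, hab⟩ => ⟨h.symm, b, a, hb, ha, hab.symm⟩⟩
  loopless := ⟨fun _ h => h.1 rfl⟩

section Contract

variable {V : Type*} {G : SimpleGraph V} {T : Set V} {r : V}

theorem HasK4Minor.of_contract (hr : r ∈ T) (hT : (G.induce T).Connected)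
    (h : HasK4Minor (contract G T r)) : HasK4Minor G := by
  refine h.of_branchSets (fun x => {a | a = x.1 ∨ x.1 = r ∧ a ∈ T}) ?_ ?_ ?_
  · rintro ⟨x, hx⟩
    by_cases hxr : x = r
    · have : {a | a = x ∨ x = r ∧ a ∈ T} = T := by
        ext a
        simp only [Set.mem_ofPred_eq, hxr, true_and, or_iff_right_iff_imp]
        rintro rfl
        exact hr
      change (G.induce {a | a = x ∨ x = r ∧ a ∈ T}).Connected
      rw [this]
      exact hT
    · exact connected_induce_of_star (c := x) (.inl rfl) fun a ha hax => by
        simp only [Set.mem_ofPred_eq] at ha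
        tauto
  · rintro ⟨x, hx⟩ ⟨y, hy⟩ a ha hb
    simp only [Set.mem_ofPred_eq] at ha hb
    rw [Subtype.mk.injEq]
    grind
  · rintro x y ⟨-, a, b, ha, hb, hab⟩
    exact ⟨a, ha, b, hb, hab⟩

theorem card_contract_lt [Finite V] {s : V} (hs : s ∈ T) (hsr : s ≠ r) :
    Nat.card {x : V // x ∉ T ∨ x = r} < Nat.card V := by
  have := Fintype.ofFinite V
  classical
  rw [Nat.card_eq_fintype_card, Nat.card_eq_fintype_card]
  exact Fintype.card_subtype_lt (x := s) (by tauto)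

theorem HasThreeNeighbors.contract_of_ne {z : {x : V // x ∉ T ∨ x = r}} (hr : r ∈ T)
    (hz : z.1 ≠ r)
    {a b c : V} (hab : a ≠ b) (hac : a ≠ c) (hbc : b ≠ c) (ha : G.Adj z a) (hb : G.Adj z b)
    (hc : G.Adj z c) (hab' : ¬ (a ∈ T ∧ b ∈ T)) (hac' : ¬ (a ∈ T ∧ c ∈ T))
    (hbc' : ¬ (b ∈ T ∧ c ∈ T)) : HasThreeNeighbors (contract G T r) z := by
  classical
  have key (x : V) (hx : G.Adj z x) : ∃ x' : {x : V // x ∉ T ∨ x = r}, (contract G T r).Adj z x' ∧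
      (x ∉ T → x'.1 = x) ∧ (x ∈ T → x'.1 = r) := by
    by_cases hxT : x ∈ T
    · exact ⟨⟨r, .inr rfl⟩, ⟨fun h => hz (by rw [h]), z, x, .inl rfl, .inr ⟨rfl, hxT⟩, hx⟩,
        fun h => absurd hxT h, fun _ => rfl⟩
    · exact ⟨⟨x, .inl hxT⟩, ⟨fun h => hx.ne (by rw [h]), z, x, .inl rfl, .inl rfl, hx⟩,
        fun _ => rfl, fun h => absurd h hxT⟩
  have ne {x y : V} (hxy : x ≠ y) (hT : ¬ (x ∈ T ∧ y ∈ T)) {x' y' : {x : V // x ∉ T ∨ x = r}}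
      (hx : (x ∉ T → x'.1 = x) ∧ (x ∈ T → x'.1 = r))
      (hy : (y ∉ T → y'.1 = y) ∧ (y ∈ T → y'.1 = r)) : x' ≠ y' := by
    rintro rfl
    by_cases h1 : x ∈ T <;> by_cases h2 : y ∈ T <;> grind
  obtain ⟨a', ha1, ha2⟩ := key a ha
  obtain ⟨b', hb1, hb2⟩ := key b hb
  obtain ⟨c', hc1, hc2⟩ := key c hc
  exact ⟨a', b', c', ne hab hab' ha2 hb2, ne hac hac' ha2 hc2, ne hbc hbc' hb2 hc2, ha1, hb1, hc1⟩

theorem HasThreeNeighbors.contract_of_eq {z : {x : V // x ∉ T ∨ x = r}} (hz : z.1 = r)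
    {a b c a' b' c' : V} (hab : a ≠ b) (hac : a ≠ c) (hbc : b ≠ c) (ha : G.Adj a' a)
    (hb : G.Adj b' b) (hc : G.Adj c' c) (haT : a ∉ T) (hbT : b ∉ T) (hcT : c ∉ T) (hr : r ∈ T)
    (ha' : a' ∈ T) (hb' : b' ∈ T) (hc' : c' ∈ T) : HasThreeNeighbors (contract G T r) z := by
  have key (x x' : V) (hx : G.Adj x' x) (hxT : x ∉ T) (hx' : x' ∈ T) :
      (contract G T r).Adj z ⟨x, .inl hxT⟩ :=
    ⟨fun h => hxT (by rw [h] at hz; change x = r at hz; rwa [hz]), x', x, .inr ⟨hz, hx'⟩, .inl rfl, hx⟩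
  exact ⟨⟨a, .inl haT⟩, ⟨b, .inl hbT⟩, ⟨c, .inl hcT⟩, by simpa, by simpa, by simpa,
    key a a' ha haT ha', key b b' hb hbT hb', key c c' hc hcT hc'⟩

end Contract

/-- If `v` has at least three neighbours but at most one outside `{u, x}`, then any neighbour
`w ≠ u` of `v` leaves room for exactly one further neighbour besides `u` and `w`. -/
theorem HasThreeNeighbors.exists_third {V : Type*} {G : SimpleGraph V} {v u w x : V}
    (h3 : HasThreeNeighbors G v) (hw : G.Adj v w) (hwu : w ≠ u)
    (hv : ∀ p q, G.Adj v p → G.Adj v q → p ≠ u → p ≠ x → q ≠ u → q ≠ x → p = q) :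
    ∃ y, G.Adj v y ∧ y ≠ u ∧ y ≠ w ∧ ∀ p, G.Adj v p → p = u ∨ p = w ∨ p = y := by
  obtain ⟨y, hy, hyu, hyw⟩ : ∃ y, G.Adj v y ∧ y ≠ u ∧ y ≠ w := by
    obtain ⟨a, b, c, hab, hac, hbc, ha, hb, hc⟩ := h3
    clear hv
    grind
  refine ⟨y, hy, hyu, hyw, fun p hp => ?_⟩
  by_contra! hcon
  obtain ⟨hpu, hpw, hpy⟩ := hcon
  by_cases hwx : w = x
  · exact hpy (hv p y hp hy hpu (hwx ▸ hpw) hyu (hwx ▸ hyw))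
  · by_cases hyx : y = x
    · exact hpw (hv p w hp hw hpu (hyx ▸ hpy) hwu hwx)
    · exact hyw (hv y w hy hw hyu hyx hwu hwx)

/-- A finite graph with an edge at `u` in which every vertex other than `u` has at least three
neighbours has a `K₄` minor. -/
theorem hasK4Minor_of_forall_ne_hasThreeNeighbors {V : Type*} [Finite V] {G : SimpleGraph V}
    {u x : V} (hx : G.Adj u x) (h3 : ∀ v, v ≠ u → HasThreeNeighbors G v) : HasK4Minor G := by
  induction hn : Nat.card V using Nat.strong_induction_on generalizing V with
  | _ n ih =>
  subst hn
  by_contra hK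
  have contr {T : Set V} {r s : V} (hr : r ∈ T) (hs : s ∈ T) (hsr : s ≠ r)
      (hT : (G.induce T).Connected) (u' x' : {x : V // x ∉ T ∨ x = r})
      (hux : (contract G T r).Adj u' x') : ∃ v, v ≠ u' ∧ ¬ HasThreeNeighbors (contract G T r) v := by
    by_contra! hcon
    exact hK ((ih _ (card_contract_lt hs hsr) hux hcon rfl).of_contract hr hT)
  have step (x : V) (hx : G.Adj u x) : ∃ v, G.Adj u v ∧ G.Adj x v ∧
      ∀ p q, G.Adj v p → G.Adj v q → p ≠ u → p ≠ x → q ≠ u → q ≠ x → p = q := by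
    obtain ⟨a, hxa, hau⟩ : ∃ a, G.Adj x a ∧ a ≠ u := by
      obtain ⟨a, b, c, hab, -, -, ha, hb, -⟩ := h3 x hx.ne'
      by_cases h : a = u
      · exact ⟨b, hb, fun h' => hab (h.trans h'.symm)⟩
      · exact ⟨a, ha, h⟩
    obtain ⟨⟨v, hv⟩, hvu, hv3⟩ := contr (T := {u, x}) (r := u) (s := x) (by simp) (by simp) hx.ne'
      (connected_induce_of_star (c := u) (by simp) (by simp [hx])) ⟨u, .inr rfl⟩
      ⟨a, .inl (by simp [hau, hxa.ne'])⟩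
      ⟨by simpa using hau.symm, x, a, .inr ⟨rfl, by simp⟩, .inl rfl, hxa⟩
    have hvu' : v ≠ u := by simpa using hvu
    have hvx : v ≠ x := by
      rintro rfl
      simp [hvu'] at hv
    obtain ⟨a, b, c, hab, hac, hbc, ha, hb, hc⟩ := h3 v hvu'
    have huv : G.Adj v u ∧ G.Adj v x := by
      by_contra hcon
      refine hv3 (.contract_of_ne (by simp) hvu' hab hac hbc ha hb hc ?_ ?_ ?_) <;>
      · simp only [Set.mem_insert_iff, Set.mem_singleton_iff]
        grind
    refine ⟨v, huv.1.symm, huv.2.symm, fun p q hp hq hpu hpx hqu hqx => ?_⟩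
    by_contra hpq
    refine hv3 (.contract_of_ne (a := u) (b := p) (c := q) (by simp) hvu' hpu.symm hqu.symm hpq
      huv.1 hp hq ?_ ?_ ?_) <;> simp [*]
  obtain ⟨v, huv, -, hv⟩ := step x hx
  obtain ⟨w, huw, hvw, hw⟩ := step v huv
  obtain ⟨y, hvy, hyu, hyw, hvN⟩ := (h3 v huv.ne').exists_third hvw huw.ne' hv
  obtain ⟨z, hwz, hzu, hzv, hwN⟩ := (h3 w huw.ne').exists_third hvw.symm huv.ne' hw
  clear hv hw step
  by_cases hyz : y = z
  · subst hyz
    by_cases hcom : ∃ t, G.Adj u t ∧ (t = y ∨ G.Adj y t) ∧ t ≠ v ∧ t ≠ w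
    · obtain ⟨t, hut, hyt, htv, htw⟩ := hcom
      refine hK (hasK4Minor_of_triangle (Y := {y, t}) huv huw hvw
        (connected_induce_of_star (c := y) (by simp) ?_) ?_ ?_ ?_
        ⟨t, by simp, hut⟩ ⟨y, by simp, hvy⟩ ⟨y, by simp, hwz⟩)
      · simp only [Set.mem_insert_iff, Set.mem_singleton_iff]
        grind
      · simp [hyu.symm, hut.ne]
      · simp [hvy.ne, htv.symm]
      · simp [hwz.ne, htw.symm]
    · obtain ⟨a, hya, hav, haw⟩ : ∃ a, G.Adj y a ∧ a ≠ v ∧ a ≠ w := by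
        obtain ⟨a, b, c, hab, hac, hbc, ha, hb, hc⟩ := h3 y hyu
        grind
      have hau : a ≠ u := by
        rintro rfl
        exact hcom ⟨y, hya.symm, .inl rfl, hzv, hyw⟩
      obtain ⟨⟨t, ht⟩, htu, ht3⟩ := contr (T := {u, v, w, y}) (r := u) (s := v) (by simp) (by simp)
        huv.ne' (connected_induce_of_star (c := v) (by simp) (by simp [hvw, hvy, huv.symm]))
        ⟨u, .inr rfl⟩ ⟨a, .inl (by simp [hau, hav, haw, hya.ne'])⟩
        ⟨by simpa using hau.symm, y, a, .inr ⟨rfl, by simp⟩, .inl rfl, hya⟩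
      have htu' : t ≠ u := by simpa using htu
      simp only [Set.mem_insert_iff, Set.mem_singleton_iff, htu', or_false, false_or] at ht
      obtain ⟨a, b, c, hab, hac, hbc, ha, hb, hc⟩ := h3 t htu'
      have hT (p q : V) (hpq : p ≠ q) (hp : G.Adj t p) (hq : G.Adj t q) :
          ¬ (p ∈ ({u, v, w, y} : Set V) ∧ q ∈ ({u, v, w, y} : Set V)) := by
        simp only [Set.mem_insert_iff, Set.mem_singleton_iff]
        have := hvN t
        have := hwN t
        have := hp.symm
        have := hq.symm
        grind
      exact ht3 (.contract_of_ne (by simp) htu' hab hac hbc ha hb hc (hT _ _ hab ha hb)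
        (hT _ _ hac ha hc) (hT _ _ hbc hb hc))
  · obtain ⟨⟨t, ht⟩, htu, ht3⟩ := contr (T := {v, w}) (r := v) (s := w) (by simp) (by simp)
      hvw.ne' (connected_induce_of_star (c := v) (by simp) (by simp [hvw]))
      ⟨u, .inl (by simp [huv.ne, huw.ne])⟩ ⟨v, .inr rfl⟩
      ⟨by simpa using huv.ne, u, v, .inl rfl, .inl rfl, huv⟩
    have htu' : t ≠ u := by simpa using htu
    by_cases htv : t = v
    · exact ht3 (.contract_of_eq htv (a := u) (b := y) (c := z) hyu.symm hzu.symm hyz huv.symm hvy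
        hwz (by simp [huv.ne, huw.ne]) (by simp [hvy.ne', hyw]) (by simp [hzv, hwz.ne'])
        (by simp) (by simp) (by simp) (by simp))
    · simp only [Set.mem_insert_iff, Set.mem_singleton_iff, htv, or_false, false_or] at ht
      obtain ⟨a, b, c, hab, hac, hbc, ha, hb, hc⟩ := h3 t htu'
      have hT (p q : V) (hpq : p ≠ q) (hp : G.Adj t p) (hq : G.Adj t q) :
          ¬ (p ∈ ({v, w} : Set V) ∧ q ∈ ({v, w} : Set V)) := by
        simp only [Set.mem_insert_iff, Set.mem_singleton_iff]
        have := hvN t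
        have := hwN t
        have := hp.symm
        have := hq.symm
        grind
      exact ht3 (.contract_of_ne (by simp) htv hab hac hbc ha hb hc (hT _ _ hab ha hb)
        (hT _ _ hac ha hc) (hT _ _ hbc hb hc))

/-- Dirac: a nonempty finite graph without a `K₄` minor has a vertex with at most two neighbours. -/
theorem exists_not_hasThreeNeighbors {V : Type*} [Finite V] [Nonempty V] {G : SimpleGraph V}
    (hG : ¬ HasK4Minor G) : ∃ v, ¬ HasThreeNeighbors G v := by
  by_contra! h
  obtain ⟨u⟩ := ‹Nonempty V›
  obtain ⟨a, -, -, -, -, -, ha, -, -⟩ := h u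
  exact hG (hasK4Minor_of_forall_ne_hasThreeNeighbors ha fun v _ => h v)

theorem exists_forall_adj_of_not_hasThreeNeighbors {V : Type*} {G : SimpleGraph V} {v : V}
    (hv : ¬ HasThreeNeighbors G v) : (∀ p, ¬ G.Adj v p) ∨
      ∃ a b, G.Adj v a ∧ G.Adj v b ∧ ∀ p, G.Adj v p → p = a ∨ p = b := by
  by_contra! h
  obtain ⟨⟨a, ha⟩, h⟩ := h
  obtain ⟨b, hb, hba, -⟩ := h a a ha ha
  obtain ⟨c, hc, hca, hcb⟩ := h a b ha hb
  exact hv ⟨a, b, c, hba.symm, hca.symm, hcb.symm, ha, hb, hc⟩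

/-- The graph obtained from `G` by deleting `v` and making its neighbours pairwise adjacent. -/
def eliminate {V : Type*} (G : SimpleGraph V) (v : V) : SimpleGraph {x : V // x ≠ v} where
  Adj x y := G.Adj x y ∨ x ≠ y ∧ G.Adj v x ∧ G.Adj v y
  symm := ⟨fun _ _ h => h.imp (fun h => h.symm) fun ⟨h, hx, hy⟩ => ⟨h.symm, hy, hx⟩⟩
  loopless := ⟨fun _ h => h.elim (fun h => h.ne rfl) fun h => h.1 rfl⟩

theorem HasK4Minor.of_eliminate {V : Type*} {G : SimpleGraph V} {v : V}
    (hv : ¬ HasThreeNeighbors G v) (h : HasK4Minor (eliminate G v)) : HasK4Minor G := by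
  obtain ⟨a, b, hN⟩ : ∃ a b, ∀ p, G.Adj v p → p = a ∨ p = b := by
    rcases exists_forall_adj_of_not_hasThreeNeighbors hv with h | ⟨a, b, -, -, h⟩
    exacts [⟨v, v, fun p hp => absurd hp (h p)⟩, ⟨a, b, h⟩]
  refine h.of_branchSets (fun x => {p | p = x.1 ∨ p = v ∧ x.1 = a ∧ G.Adj v a}) ?_ ?_ ?_
  · rintro ⟨x, hx⟩
    refine connected_induce_of_star (c := x) (.inl rfl) ?_
    rintro p (rfl | ⟨rfl, rfl, hpa⟩) hpx
    exacts [absurd rfl hpx, hpa.symm]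
  · rintro ⟨x, hx⟩ ⟨y, hy⟩ p hp hp'
    simp only [Set.mem_ofPred_eq] at hp hp'
    rw [Subtype.mk.injEq]
    grind
  · rintro ⟨x, hx⟩ ⟨y, hy⟩ (hxy | ⟨hne, hvx, hvy⟩)
    · exact ⟨x, .inl rfl, y, .inl rfl, hxy⟩
    · have hne' : x ≠ y := by simpa using hne
      by_cases hxa : x = a
      · exact ⟨v, .inr ⟨rfl, hxa, hxa ▸ hvx⟩, y, .inl rfl, hvy⟩
      · have hya : y = a := by
          have := hN x hvx
          have := hN y hvy
          grind
        exact ⟨x, .inl rfl, v, .inr ⟨rfl, hya, hya ▸ hvy⟩, SimpleGraph.Adj.symm hvx⟩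

theorem exists_sets_of_isHalfMetric {V : Type*} [Finite V] {G : SimpleGraph V} {k : ℕ}
    {f : V → V → ℕ} (hf : IsHalfMetric k f) (hG : ¬ HasK4Minor G) :
    ∃ A : V → Finset (Fin (2 * k + 1)), (∀ x, (A x).card = k) ∧
      ∀ x y, G.Adj x y → (A x \ A y).card = f x y := by
  induction hn : Nat.card V using Nat.strong_induction_on generalizing V with
  | _ n ih =>
  subst hn
  classical
  cases isEmpty_or_nonempty V with
  | inl _ => exact ⟨fun _ => ∅, isEmptyElim, isEmptyElim⟩
  | inr _ =>
  obtain ⟨v, hv⟩ := exists_not_hasThreeNeighbors hG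
  have hcard : Nat.card {x : V // x ≠ v} < Nat.card V := by
    have := Fintype.ofFinite V
    rw [Nat.card_eq_fintype_card, Nat.card_eq_fintype_card]
    exact Fintype.card_subtype_lt (x := v) (by simp)
  obtain ⟨A, hA, hAf⟩ := ih _ hcard (G := eliminate G v) (f := fun x y => f x y)
    ⟨fun x y => hf.symm x y, fun x y => hf.le x y, fun x y z => hf.triangle x y z,
      fun x y z => hf.perimeter x y z⟩ (fun h => hG (h.of_eliminate hv)) rfl
  obtain ⟨C, hC, hCf⟩ : ∃ C : Finset (Fin (2 * k + 1)), C.card = k ∧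
      ∀ x : {x : V // x ≠ v}, G.Adj v x → (C \ A x).card = f v x := by
    rcases exists_forall_adj_of_not_hasThreeNeighbors hv with h | ⟨a, b, hva, hvb, hN⟩
    · obtain ⟨C, -, hC⟩ := Finset.exists_subset_card_eq
        (s := (Finset.univ : Finset (Fin (2 * k + 1)))) (n := k) (by simp; omega)
      exact ⟨C, hC, fun x hx => absurd hx (h x)⟩
    · have ha := hf.le v a
      have hb := hf.le v b
      obtain ⟨C, hC, h1, h2⟩ : ∃ C : Finset (Fin (2 * k + 1)), C.card = k ∧
          (C \ A ⟨a, hva.ne'⟩).card = f v a ∧ (C \ A ⟨b, hvb.ne'⟩).card = f v b := by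
        by_cases hab : a = b
        · subst hab
          refine exists_card_sdiff_eq (by simp) _ _ (hA _) (hA _) ha ha ?_ ?_ ?_ ?_ <;>
            rw [Finset.sdiff_self, Finset.card_empty] <;> omega
        · have := hAf ⟨a, hva.ne'⟩ ⟨b, hvb.ne'⟩ (.inr ⟨by simpa using hab, hva, hvb⟩)
          have t1 := hf.triangle a v b
          have t2 := hf.triangle v a b
          have t3 := hf.triangle v b a
          have t4 := hf.perimeter a v b
          rw [hf.symm a v] at t1 t4
          rw [hf.symm b a] at t3
          refine exists_card_sdiff_eq (by simp) _ _ (hA _) (hA _) ha hb ?_ ?_ ?_ ?_ <;>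
            rw [this] <;> dsimp only <;> omega
      refine ⟨C, hC, fun ⟨x, hx⟩ hvx => ?_⟩
      rcases hN x hvx with rfl | rfl
      exacts [h1, h2]
  refine ⟨fun x => if h : x = v then C else A ⟨x, h⟩, fun x => ?_, fun x y hxy => ?_⟩
  · dsimp only
    split_ifs
    exacts [hC, hA _]
  · by_cases hx : x = v
    · subst hx
      simpa [hxy.ne'] using hCf ⟨y, hxy.ne'⟩ hxy
    · by_cases hy : y = v
      · subst hy
        dsimp only
        rw [dif_neg hx, dif_pos rfl, Finset.card_sdiff_comm ((hA _).trans hC.symm), hf.symm]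
        exact hCf ⟨x, hx⟩ hxy.symm
      · simpa [hx, hy] using hAf ⟨x, hx⟩ ⟨y, hy⟩ (.inl hxy)

theorem nonempty_hom_Kneser {V : Type*} [Finite V] {G : SimpleGraph V} {k : ℕ} (hk : 1 ≤ k)
    (h1 : ¬ HasK4Minor G) (h2 : oddGirthAtLeast G (2 * k + 1)) :
    Nonempty (G →g Kneser (2 * k + 1) k) := by
  obtain ⟨A, hA, hAf⟩ := exists_sets_of_isHalfMetric (isHalfMetric_halfDist h2) h1
  refine ⟨⟨fun x => ⟨A x, hA x⟩, fun {x y} hxy => ?_⟩⟩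
  have h := hAf x y hxy
  rw [halfDist_of_adj hk hxy] at h
  rw [Kneser_adj_iff hk]
  exact Finset.sdiff_eq_self_iff_disjoint.1
    (Finset.eq_of_subset_of_card_le Finset.sdiff_subset ((hA x).trans h.symm).le)

/-- Every finite `K₄`-minor-free graph of odd-girth at least `2k+1` has fractional
chromatic number at most `2 + 1/k`, and the bound is attained by `C_{2k+1}`. -/
theorem SP_fracChromatic {V : Type*} [Fintype V] (k : ℕ) (hk : 1 ≤ k) (G : SimpleGraph V)
    (h1 : ¬ HasK4Minor G) (h2 : oddGirthAtLeast G (2*k+1)) :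
    fracChromaticNumber G ≤ 2 + 1/(k : ℝ) ∧
    fracChromaticNumber (cycleGraphZ (2*k+1)) = 2 + 1/(k : ℝ) := by
  have hval : (((2 * k + 1 : ℕ) : ℝ)) / k = 2 + 1 / k := by
    have : (0 : ℝ) < k := by exact_mod_cast hk
    push_cast
    field_simp
  obtain ⟨φ⟩ := nonempty_hom_Kneser hk h1 h2
  exact ⟨hval ▸ fracChromaticNumber_le_of_hom (by omega) hk φ, fracChromaticNumber_cycleGraphZ hk⟩
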